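/- Let f(x; w) = W_L ⋯ W_1 x be a deep linear network of depth L with single output (d_L = 1), with each weight matrix W_l ∈ ℝ^{d_l × d_{l−1}} nonzero, and let F(w) = √d₀·∏_{l=1}^L ‖W_l‖_*. Let x₁,…,x_m ∈ ℝ^{d₀} satisfy ‖xᵢ‖₂ = √d₀ for all i, and let Δw = (ΔW_1,…,ΔW_L) be any weight perturbation. Let Δf_X ∈ ℝᵐ have entries f(xᵢ; w+Δw) − f(xᵢ; w), and let ∇_w f_X Δw ∈ ℝᵐ denote the linearisation, whose i-th entry is Σ_{l=1}^L W_L ⋯ W_{l+1} ΔW_l W_{l−1} ⋯ W_1 xᵢ. Then: ‖Δf_X − ∇_w f_X Δw‖₂ / √m ≤ F(w) · [ ∏_{l=1}^L (1 + ‖ΔW_l‖_*/‖W_l‖_*) − 1 − Σ_{l=1}^L ‖ΔW_l‖_*/‖W_l‖_* ]. -/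

import Mathlib

/-- The spectral norm (largest singular value) of a real matrix, as the operator norm of
the induced linear map between Euclidean spaces. -/
noncomputable def specNorm {p q : ℕ} (A : Matrix (Fin p) (Fin q) ℝ) : ℝ :=
  ‖LinearMap.toContinuousLinearMap (Matrix.toEuclideanLin A)‖

/-- A deep linear network: `netFwd d W L x = W_{L} ⋯ W_1 x` where the `l`-th weight matrix
(0-indexed) `W l` has dimensions `d (l+1) × d l`. -/
def netFwd (d : ℕ → ℕ) (W : ∀ l : ℕ, Matrix (Fin (d (l + 1))) (Fin (d l)) ℝ) :
    (L : ℕ) → (Fin (d 0) → ℝ) → Fin (d L) → ℝ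
  | 0, x => x
  | L + 1, x => (W L).mulVec (netFwd d W L x)

/-- The Euclidean norm of a vector in `ℝⁿ`. -/
noncomputable def euclNorm {n : ℕ} (v : Fin n → ℝ) : ℝ :=
  Real.sqrt (∑ i, (v i) ^ 2)

theorem euclNorm_eq {n : ℕ} (v : Fin n → ℝ) : euclNorm v = ‖WithLp.toLp 2 v‖ := by
  simp [euclNorm, EuclideanSpace.norm_eq]

theorem euclNorm_add_le {n : ℕ} (u v : Fin n → ℝ) :
    euclNorm (u + v) ≤ euclNorm u + euclNorm v := by
  simp only [euclNorm_eq, WithLp.toLp_add]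
  exact norm_add_le _ _

theorem euclNorm_nn {n : ℕ} (v : Fin n → ℝ) : 0 ≤ euclNorm v := Real.sqrt_nonneg _

theorem specNorm_nn {p q : ℕ} (A : Matrix (Fin p) (Fin q) ℝ) : 0 ≤ specNorm A :=
  norm_nonneg _

theorem specNorm_ne {p q : ℕ} (A : Matrix (Fin p) (Fin q) ℝ) (h : A ≠ 0) : specNorm A ≠ 0 := by
  intro h0
  apply h
  simpa [specNorm] using h0

theorem euclNorm_mulVec_le {p q : ℕ} (A : Matrix (Fin p) (Fin q) ℝ) (v : Fin q → ℝ) :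
    euclNorm (A.mulVec v) ≤ specNorm A * euclNorm v := by
  have := (LinearMap.toContinuousLinearMap (Matrix.toEuclideanLin A)).le_opNorm (WithLp.toLp 2 v)
  simpa [euclNorm_eq, specNorm] using this

theorem euclNorm_one {n : ℕ} (h : n = 1) (v : Fin n → ℝ) : |∑ j, v j| = euclNorm v := by
  subst h
  simp [euclNorm, Real.sqrt_sq_eq_abs]

theorem netFwd_congr (d : ℕ → ℕ) (W V : ∀ l : ℕ, Matrix (Fin (d (l + 1))) (Fin (d l)) ℝ)
    (L : ℕ) (h : ∀ l < L, W l = V l) (x : Fin (d 0) → ℝ) : netFwd d W L x = netFwd d V L x := by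
  induction L with
  | zero => rfl
  | succ L ih =>
    simp only [netFwd]
    rw [ih (fun l hl => h l (by omega)), h L (by omega)]

theorem key_nonneg (t : ℕ → ℝ) (ht : ∀ l, 0 ≤ t l) (L : ℕ) :
    0 ≤ (∏ l ∈ Finset.range L, (1 + t l)) - 1 - ∑ l ∈ Finset.range L, t l := by
  induction L with
  | zero => simp
  | succ L ih =>
    rw [Finset.prod_range_succ, Finset.sum_range_succ]
    have h1 : 0 ≤ ∑ l ∈ Finset.range L, t l := Finset.sum_nonneg (fun l _ => ht l)
    nlinarith [ht L, mul_nonneg (ht L) ih, mul_nonneg (ht L) h1]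

theorem key_bound (d : ℕ → ℕ) (W ΔW : ∀ l : ℕ, Matrix (Fin (d (l + 1))) (Fin (d l)) ℝ)
    (x : Fin (d 0) → ℝ) (L : ℕ) (hW : ∀ l < L, W l ≠ 0) :
    euclNorm (netFwd d W L x) ≤ euclNorm x * ∏ l ∈ Finset.range L, specNorm (W l) ∧
    euclNorm (netFwd d (fun l => W l + ΔW l) L x - netFwd d W L x) ≤
      (euclNorm x * ∏ l ∈ Finset.range L, specNorm (W l)) *
        ((∏ l ∈ Finset.range L, (1 + specNorm (ΔW l) / specNorm (W l))) - 1) ∧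
    euclNorm (netFwd d (fun l => W l + ΔW l) L x - netFwd d W L x -
      ∑ l ∈ Finset.range L, netFwd d (fun k => if k = l then ΔW k else W k) L x) ≤
      (euclNorm x * ∏ l ∈ Finset.range L, specNorm (W l)) *
        ((∏ l ∈ Finset.range L, (1 + specNorm (ΔW l) / specNorm (W l))) - 1
          - ∑ l ∈ Finset.range L, specNorm (ΔW l) / specNorm (W l)) := by
  induction L with
  | zero => simp [netFwd, euclNorm]
  | succ L ih =>
    obtain ⟨h1, h2, h3⟩ := ih (fun l hl => hW l (by omega))
    have ha := specNorm_ne _ (hW L (by omega))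
    have hD : ∑ l ∈ Finset.range (L + 1),
        netFwd d (fun k => if k = l then ΔW k else W k) (L + 1) x =
        (W L).mulVec (∑ l ∈ Finset.range L, netFwd d (fun k => if k = l then ΔW k else W k) L x)
          + (ΔW L).mulVec (netFwd d W L x) := by
      rw [Finset.sum_range_succ, Matrix.mulVec_sum]
      congr 1
      · apply Finset.sum_congr rfl
        intro l hl
        have : L ≠ l := by have := Finset.mem_range.mp hl; omega
        simp only [netFwd, if_neg this]
      · simp only [netFwd, if_true]
        rw [netFwd_congr d (fun k => if k = L then ΔW k else W k) W L]
        intro l hl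
        simp only [if_neg (show l ≠ L by omega)]
    rw [hD]
    simp only [netFwd]
    simp only [Finset.prod_range_succ, Finset.sum_range_succ]
    set f := netFwd d W L x
    set g := netFwd d (fun l => W l + ΔW l) L x
    set D := ∑ l ∈ Finset.range L, netFwd d (fun k => if k = l then ΔW k else W k) L x
    set A := ∏ l ∈ Finset.range L, specNorm (W l)
    set P := ∏ l ∈ Finset.range L, (1 + specNorm (ΔW l) / specNorm (W l))
    set S := ∑ l ∈ Finset.range L, specNorm (ΔW l) / specNorm (W l)
    have na := specNorm_nn (W L)
    have nb := specNorm_nn (ΔW L)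
    refine ⟨?_, ?_, ?_⟩
    · calc _ ≤ specNorm (W L) * euclNorm f := euclNorm_mulVec_le _ _
        _ ≤ specNorm (W L) * (euclNorm x * A) := by gcongr
        _ = _ := by ring
    · have e : (W L + ΔW L).mulVec g - (W L).mulVec f =
          (W L).mulVec (g - f) + ((ΔW L).mulVec (g - f) + (ΔW L).mulVec f) := by
        simp only [Matrix.add_mulVec, Matrix.mulVec_sub]; abel
      rw [e]
      calc _ ≤ specNorm (W L) * euclNorm (g - f) +
            (specNorm (ΔW L) * euclNorm (g - f) + specNorm (ΔW L) * euclNorm f) := by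
            refine (euclNorm_add_le _ _).trans (add_le_add (euclNorm_mulVec_le _ _) ?_)
            exact (euclNorm_add_le _ _).trans
              (add_le_add (euclNorm_mulVec_le _ _) (euclNorm_mulVec_le _ _))
        _ ≤ specNorm (W L) * (euclNorm x * A * (P - 1)) +
            (specNorm (ΔW L) * (euclNorm x * A * (P - 1)) +
              specNorm (ΔW L) * (euclNorm x * A)) := by gcongr
        _ = _ := by field_simp; ring
    · have e : (W L + ΔW L).mulVec g - (W L).mulVec f - ((W L).mulVec D + (ΔW L).mulVec f) =
          (W L).mulVec (g - f - D) + (ΔW L).mulVec (g - f) := by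
        simp only [Matrix.add_mulVec, Matrix.mulVec_sub]; abel
      rw [e]
      calc _ ≤ specNorm (W L) * euclNorm (g - f - D) + specNorm (ΔW L) * euclNorm (g - f) :=
            (euclNorm_add_le _ _).trans
              (add_le_add (euclNorm_mulVec_le _ _) (euclNorm_mulVec_le _ _))
        _ ≤ specNorm (W L) * (euclNorm x * A * (P - 1 - S)) +
            specNorm (ΔW L) * (euclNorm x * A * (P - 1)) := by gcongr
        _ = _ := by field_simp; ring

theorem euclNorm_le_of {m : ℕ} (v : Fin m → ℝ) (B : ℝ) (hB : 0 ≤ B) (h : ∀ i, |v i| ≤ B) :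
    euclNorm v / Real.sqrt m ≤ B := by
  apply div_le_of_le_mul₀ (Real.sqrt_nonneg _) hB
  rw [euclNorm]
  apply Real.sqrt_le_iff.mpr
  refine ⟨by positivity, ?_⟩
  rw [mul_pow, Real.sq_sqrt (by positivity)]
  calc ∑ i, v i ^ 2 ≤ ∑ _i : Fin m, B ^ 2 :=
        Finset.sum_le_sum (fun i _ => sq_le_sq' (abs_le.mp (h i)).1 (abs_le.mp (h i)).2)
    _ = _ := by simp; ring

/-- Second architectural perturbation bound for a deep linear network
with a single output (`d L = 1`): the deviation of the projected functional perturbation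
from its linearisation `(∇_w f_X Δw)ᵢ = ∑ₗ W_L⋯W_{l+1} ΔW_l W_{l−1}⋯W_1 xᵢ` satisfies
`‖Δf_X − ∇_w f_X Δw‖₂/√m ≤ F(w)·[∏ₗ(1 + ‖ΔWₗ‖_*/‖Wₗ‖_*) − 1 − ∑ₗ ‖ΔWₗ‖_*/‖Wₗ‖_*]`. -/
theorem deep_linear_network_linearisation_bound (L : ℕ) (d : ℕ → ℕ) (hdL : d L = 1)
    (W ΔW : ∀ l : ℕ, Matrix (Fin (d (l + 1))) (Fin (d l)) ℝ)
    (hW : ∀ l < L, W l ≠ 0)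
    (m : ℕ) (x : Fin m → Fin (d 0) → ℝ)
    (hx : ∀ i, euclNorm (x i) = Real.sqrt (d 0)) :
    euclNorm (fun i =>
        ((∑ j, netFwd d (fun l => W l + ΔW l) L (x i) j) - ∑ j, netFwd d W L (x i) j)
          - ∑ l ∈ Finset.range L,
              ∑ j, netFwd d (fun k => if k = l then ΔW k else W k) L (x i) j)
        / Real.sqrt m
      ≤ (Real.sqrt (d 0) * ∏ l ∈ Finset.range L, specNorm (W l)) *
          ((∏ l ∈ Finset.range L, (1 + specNorm (ΔW l) / specNorm (W l))) - 1
            - ∑ l ∈ Finset.range L, specNorm (ΔW l) / specNorm (W l)) := by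
  have hnn := key_nonneg (fun l => specNorm (ΔW l) / specNorm (W l))
    (fun l => div_nonneg (specNorm_nn _) (specNorm_nn _)) L
  apply euclNorm_le_of
  · exact mul_nonneg (mul_nonneg (Real.sqrt_nonneg _)
      (Finset.prod_nonneg (fun l _ => specNorm_nn _))) hnn
  · intro i
    have h := (key_bound d W ΔW (x i) L hW).2.2
    rw [hx i, ← euclNorm_one hdL] at h
    refine le_of_eq_of_le ?_ h
    congr 1
    rw [Finset.sum_comm]
    simp only [Pi.sub_apply, Finset.sum_apply, Finset.sum_sub_distrib]
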